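/- Let p be a prime and G an abelian bi-Δ-group which is p-local and satisfies 𝔥_i G = 0 for all i ≤ k. Then for every m with 1 ≤ m ≤ p + k there exists a homomorphism π_m : 𝔥_m G → Z_m G restricting to the identity on Z_m G, and for every such π_m and every n ≥ m the endomorphism e_m^{(n)} = H_{m,n} ∘ i_m ∘ π_m ∘ p_{m,n} of 𝔥_n G is idempotent. -/

import Mathlib

universe u

section

variable (G : ℕ → Type u) [∀ n, AddCommGroup (G n)]
variable (d : ∀ n : ℕ, ℕ → (G (n + 1) →+ G n))
variable (δ : ∀ n : ℕ, ℕ → (G n →+ G (n + 1)))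

/-- The axioms of an (abelian, additively written) bi-Δ-group: a sequence of groups `G n`
with faces `d n j : G (n+1) →+ G n` (for `j ≤ n+1`) and cofaces
`δ n i : G n →+ G (n+1)` (for `i ≤ n+1`), satisfying the simplicial-type identities. -/
structure IsBiDelta : Prop where
  face_face : ∀ n i j : ℕ, i ≤ j → j ≤ n + 1 → ∀ x : G (n + 2),
    d n i (d (n + 1) (j + 1) x) = d n j (d (n + 1) i x)
  coface_coface : ∀ n i j : ℕ, j ≤ i → i ≤ n + 1 → ∀ x : G n,
    δ (n + 1) j (δ n i x) = δ (n + 1) (i + 1) (δ n j x)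
  face_coface_lt : ∀ n i j : ℕ, j ≤ i → i ≤ n + 1 → ∀ x : G (n + 1),
    d (n + 1) j (δ (n + 1) (i + 1) x) = δ n i (d n j x)
  face_coface_eq : ∀ n i : ℕ, i ≤ n + 1 → ∀ x : G n, d n i (δ n i x) = x
  face_coface_gt : ∀ n i j : ℕ, i ≤ j → j ≤ n + 1 → ∀ x : G (n + 1),
    d (n + 1) (j + 1) (δ (n + 1) i x) = δ n i (d n j x)

/-- The `n`-th Cohen group `𝔥_n G = {x ∈ G_n : d_0 x = d_1 x = ⋯ = d_n x}`
(with `𝔥_0 G = G_0`), as a subgroup of `G n`. -/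
def cohenAll : ∀ n : ℕ, AddSubgroup (G n)
  | 0 => ⊤
  | m + 1 =>
    { carrier := { x : G (m + 1) | ∀ j, j ≤ m + 1 → d m j x = d m 0 x }
      add_mem' := fun {a b} ha hb j hj => by
        simp only [Set.mem_setOf_eq] at ha hb ⊢
        rw [map_add, map_add, ha j hj, hb j hj]
      zero_mem' := fun j hj => by simp
      neg_mem' := fun {a} ha j hj => by
        simp only [Set.mem_setOf_eq] at ha ⊢
        rw [map_neg, map_neg, ha j hj] }

/-- The `n`-th Moore cycle group `Z_n G = ⋂_{j=0}^n ker d_j` (with `Z_0 G = G_0`),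
as a subgroup of `G n`. -/
def mooreAll : ∀ n : ℕ, AddSubgroup (G n)
  | 0 => ⊤
  | m + 1 =>
    { carrier := { x : G (m + 1) | ∀ j, j ≤ m + 1 → d m j x = 0 }
      add_mem' := fun {a b} ha hb j hj => by
        simp only [Set.mem_setOf_eq] at ha hb ⊢
        rw [map_add, ha j hj, hb j hj, add_zero]
      zero_mem' := fun j hj => by simp
      neg_mem' := fun {a} ha j hj => by
        simp only [Set.mem_setOf_eq] at ha ⊢
        rw [map_neg, ha j hj, neg_zero] }

/-- Iterated cofaces `d^{c(r-1)} d^{c(r-2)} ⋯ d^{c(0)}(x)` along a tuple `c` of coface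
indices (`c 0` is applied first, at level `k`). -/
def iterCoface (k : ℕ) : ∀ r : ℕ, (Fin r → ℕ) → G k → G (k + r)
  | 0, _, x => x
  | r + 1, c, x => δ (k + r) (c (Fin.last r)) (iterCoface k r (fun i => c i.castSucc) x)

open Classical in
/-- The James–Hopf homomorphism `H_{k,n} : G_k → G_n` (`n = k + r`): the sum, over all
strictly increasing tuples `0 ≤ i_1 < i_2 < ⋯ < i_{n-k} ≤ n`, of
`d^{i_{n-k}} d^{i_{n-k-1}} ⋯ d^{i_1}(x)`. -/
noncomputable def jamesHopf (k r : ℕ) (x : G k) : G (k + r) :=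
  ∑ c ∈ Finset.univ.filter (fun c : Fin r → Fin (k + r + 1) => StrictMono c),
    iterCoface G δ k r (fun i => (c i : ℕ)) x

/-- `σ_{m+1} = H_{m,m+1} = Σ_{i=0}^{m+1} d^i : G m →+ G (m+1)` (as a function). -/
def sigmaMap (m : ℕ) (x : G m) : G (m + 1) :=
  ∑ i ∈ Finset.range (m + 2), δ m i x

/-- The composite `σ_{s+r} ∘ σ_{s+r-1} ∘ ⋯ ∘ σ_{s+1} : G s → G (s+r)`. -/
def sigmaIter (s : ℕ) : ∀ r : ℕ, G s → G (s + r)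
  | 0, x => x
  | r + 1, x => sigmaMap G δ (s + r) (sigmaIter s r x)

/-- The `r`-fold iterate of the zeroth face `d_0 : G (m+r) → G m`,
i.e. `p_{m+1} ∘ p_{m+2} ∘ ⋯ ∘ p_{m+r}` on Cohen groups. -/
def dIter (m : ℕ) : ∀ r : ℕ, G (m + r) → G m
  | 0, x => x
  | r + 1, x => dIter m r (d (m + r) 0 x)

end

section Helpers

variable {G : ℕ → Type u} [∀ n, AddCommGroup (G n)]
variable {d : ∀ n : ℕ, ℕ → (G (n + 1) →+ G n)}
variable {δ : ∀ n : ℕ, ℕ → (G n →+ G (n + 1))}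

theorem hlp_d_mem (h : IsBiDelta G d δ) (n : ℕ) (x : G (n + 1))
    (hx : x ∈ cohenAll G d (n + 1)) : d n 0 x ∈ cohenAll G d n := by
  cases n with
  | zero => exact AddSubgroup.mem_top _
  | succ n =>
    intro j hj
    have hx' : ∀ j, j ≤ n + 1 + 1 → d (n + 1) j x = d (n + 1) 0 x := hx
    rw [← h.face_face n 0 j (Nat.zero_le _) hj x, hx' (j + 1) (by omega)]

/-- The bundled sum of all cofaces. -/
def hlpSigma (δ : ∀ n : ℕ, ℕ → (G n →+ G (n + 1))) (n : ℕ) : G n →+ G (n + 1) :=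
  ∑ i ∈ Finset.range (n + 2), δ n i

theorem hlp_d_sigma (h : IsBiDelta G d δ) (n j : ℕ) (hj : j ≤ n + 2) (y : G (n + 1)) :
    d (n + 1) j (hlpSigma δ (n + 1) y) =
      y + ∑ i ∈ Finset.range (n + 2), δ n i (if i < j then d n (j - 1) y else d n j y) := by
  have key : ∀ i ∈ Finset.range (n + 3), d (n + 1) j (δ (n + 1) i y) =
      if i < j then δ n i (d n (j - 1) y) else if i = j then y
        else δ n (i - 1) (d n j y) := by
    intro i hi
    have hi := Finset.mem_range.1 hi
    split_ifs with h1 h2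
    · obtain ⟨j, rfl⟩ : ∃ j', j = j' + 1 := ⟨j - 1, by omega⟩
      exact h.face_coface_gt n i j (by omega) (by omega) y
    · subst h2
      exact h.face_coface_eq (n + 1) i (by omega) y
    · obtain ⟨i, rfl⟩ : ∃ i', i = i' + 1 := ⟨i - 1, by omega⟩
      exact h.face_coface_lt n i j (by omega) (by omega) y
  unfold hlpSigma
  rw [AddMonoidHom.finsetSum_apply, map_sum, Finset.sum_congr rfl key]
  obtain ⟨e, he⟩ : ∃ e, n + 3 = j + (e + 1) := ⟨n + 2 - j, by omega⟩
  have he2 : n + 2 = j + e := by omega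
  rw [show n + 1 + 2 = n + 3 from rfl, he, he2, Finset.sum_range_add _ j (e + 1),
    Finset.sum_range_add _ j e, Finset.sum_range_succ']
  have e1 : ∀ i ∈ Finset.range j, (if i < j then δ n i (d n (j - 1) y) else if i = j then y
        else δ n (i - 1) (d n j y)) = δ n i (if i < j then d n (j - 1) y else d n j y) := by
    intro i hi
    have hi := Finset.mem_range.1 hi
    simp [hi]
  rw [Finset.sum_congr rfl e1]
  simp
  abel

theorem hlp_d_sigma_const (h : IsBiDelta G d δ) (n : ℕ) (y : G (n + 1)) (w : G n)
    (hy : ∀ j, j ≤ n + 1 → d n j y = w) (j : ℕ) (hj : j ≤ n + 2) :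
    d (n + 1) j (hlpSigma δ (n + 1) y) = y + hlpSigma δ n w := by
  rw [hlp_d_sigma h n j hj y]
  unfold hlpSigma
  rw [AddMonoidHom.finsetSum_apply]
  congr 1
  refine Finset.sum_congr rfl fun i hi => ?_
  have hi := Finset.mem_range.1 hi
  split_ifs with h1
  · rw [hy _ (by omega)]
  · rw [hy _ (by omega)]

/-- `A t n = σ^t ∘ p^t` on `G n` (zero if `t > n`). -/
def hlpA (d : ∀ n : ℕ, ℕ → (G (n + 1) →+ G n)) (δ : ∀ n : ℕ, ℕ → (G n →+ G (n + 1))) :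
    ∀ (_ n : ℕ), G n →+ G n
  | 0, n => AddMonoidHom.id (G n)
  | _ + 1, 0 => 0
  | t + 1, n + 1 => (hlpSigma δ n).comp ((hlpA d δ t n).comp (d n 0))

theorem hlpA_succ (t n : ℕ) (x : G (n + 1)) :
    hlpA d δ (t + 1) (n + 1) x = hlpSigma δ n (hlpA d δ t n (d n 0 x)) := rfl

theorem hlp_A_face (h : IsBiDelta G d δ) (h0 : ∀ x : G 0, x = 0) (t : ℕ) :
    ∀ (n : ℕ) (x : G (n + 1)), x ∈ cohenAll G d (n + 1) → ∀ j, j ≤ n + 1 →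
      d n j (hlpA d δ t (n + 1) x) =
        hlpA d δ t n (d n 0 x) + t • hlpA d δ (t - 1) n (d n 0 x) := by
  induction t with
  | zero =>
    intro n x hx j hj
    have hx' : ∀ j, j ≤ n + 1 → d n j x = d n 0 x := hx
    simpa [hlpA] using hx' j hj
  | succ t ih =>
    intro n x hx j hj
    cases n with
    | zero => rw [h0 (d 0 j _), h0 (_ + _)]
    | succ n =>
      have hpx := hlp_d_mem h _ x hx
      rw [hlpA_succ, hlp_d_sigma_const h n _ _ (ih n _ hpx) j hj, map_add, map_nsmul,
        hlpA_succ, Nat.add_sub_cancel, succ_nsmul]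
      cases t with
      | zero => simp; abel
      | succ t => rw [Nat.add_sub_cancel, ← hlpA_succ t n]; abel

theorem hlp_A_zero (h : IsBiDelta G d δ) (k : ℕ)
    (hvanish : ∀ i ≤ k, ∀ x ∈ cohenAll G d i, x = 0) (t : ℕ) :
    ∀ (n : ℕ), n ≤ t + k → ∀ x ∈ cohenAll G d n, hlpA d δ t n x = 0 := by
  induction t with
  | zero => intro n hn x hx; exact hvanish n (by omega) x hx
  | succ t ih =>
    intro n hn x hx
    cases n with
    | zero => rfl
    | succ n => rw [hlpA_succ, ih n (by omega) _ (hlp_d_mem h n x hx), map_zero]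

theorem hlp_telescope {M : Type*} [AddCommGroup M] (c : ℕ → ℤ) (a : ℕ → M) (T : ℕ)
    (hc : ∀ t < T, c t + (t + 1) * c (t + 1) = 0) :
    ∑ t ∈ Finset.range (T + 1), c t • (a t + t • a (t - 1)) = c T • a T := by
  induction T with
  | zero => simp
  | succ T ih =>
    rw [Finset.sum_range_succ, ih fun t ht => hc t (by omega), Nat.add_sub_cancel]
    have hcT : c T = -(((T : ℤ) + 1) * c (T + 1)) := by linarith [hc T (by omega)]
    rw [hcT, ← natCast_zsmul]
    push_cast
    module

theorem hlp_coeff (T : ℕ) : ∃ c : ℕ → ℤ, c 0 = (T.factorial : ℤ) ∧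
    ∀ t < T, c t + (t + 1) * c (t + 1) = 0 := by
  refine ⟨fun t => (-1) ^ t * ((∏ i ∈ Finset.Ico (t + 1) (T + 1), i : ℕ) : ℤ), ?_, ?_⟩
  · simp [Finset.prod_Ico_id_eq_factorial]
  · intro t ht
    simp only
    rw [Finset.prod_eq_prod_Ico_succ_bot (by omega : t + 1 < T + 1)]
    push_cast
    ring

theorem hlp_fact_bij {M : Type*} [AddCommGroup M] (p : ℕ) 
    (hloc : ∀ q : ℕ, q.Prime → q ≠ p → Function.Bijective fun x : M => q • x)
    (N : ℕ) (hN : N ≠ 0) (hpN : ¬ p ∣ N) : Function.Bijective fun x : M => N • x := by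
  induction N using Nat.recOnMul with
  | zero => exact absurd rfl hN
  | one => simp only [one_smul]; exact Function.bijective_id
  | prime q hq => exact hloc q hq (by rintro rfl; exact hpN dvd_rfl)
  | mul a b iha ihb =>
    have ha := iha (by rintro rfl; simp at hN) (fun hh => hpN (hh.mul_right b))
    have hb := ihb (by rintro rfl; simp at hN) (fun hh => hpN (hh.mul_left a))
    have := ha.comp hb
    convert this using 2 with x
    simp [mul_smul]

theorem hlp_exists (h : IsBiDelta G d δ) (p k : ℕ) (hp : p.Prime)
    (hloc : ∀ q : ℕ, q.Prime → q ≠ p → ∀ n, Function.Bijective fun x : G n => q • x)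
    (hvanish : ∀ i ≤ k, ∀ x ∈ cohenAll G d i, x = 0)
    (m : ℕ) (hm : m + 1 ≤ p + k) :
    ∃ π : ↥(cohenAll G d (m + 1)) →+ ↥(mooreAll G d (m + 1)),
      ∀ x : ↥(cohenAll G d (m + 1)), (x : G (m + 1)) ∈ mooreAll G d (m + 1) →
        ((π x : ↥(mooreAll G d (m + 1))) : G (m + 1)) = (x : G (m + 1)) := by
  have hp1 := hp.one_lt
  have h0 : ∀ x : G 0, x = 0 := fun x => hvanish 0 (Nat.zero_le _) x (AddSubgroup.mem_top _)
  obtain ⟨T, hT⟩ : ∃ T, T = m - k := ⟨_, rfl⟩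
  obtain ⟨c, hc0, hc⟩ := hlp_coeff T
  have hbij : ∀ n, Function.Bijective fun x : G n => T.factorial • x := fun n =>
    hlp_fact_bij p (fun q hq hqp => hloc q hq hqp n) _ (Nat.factorial_ne_zero T)
      (by rw [hp.dvd_factorial]; omega)
  let e : G (m + 1) ≃+ G (m + 1) :=
    AddEquiv.ofBijective (nsmulAddMonoidHom (α := G (m + 1)) T.factorial) (hbij (m + 1))
  have he : ∀ x, T.factorial • e.symm x = x := fun x => e.apply_symm_apply x
  let S : G (m + 1) →+ G (m + 1) := ∑ t ∈ Finset.range (T + 1), c t • hlpA d δ t (m + 1)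
  have hS : ∀ x, S x = ∑ t ∈ Finset.range (T + 1), c t • hlpA d δ t (m + 1) x := fun x => by
    simp [S, AddMonoidHom.finsetSum_apply]
  have hmem : ∀ x ∈ cohenAll G d (m + 1), e.symm (S x) ∈ mooreAll G d (m + 1) := by
    intro x hx j hj
    apply (hbij m).1
    simp only
    rw [← map_nsmul, he, hS, map_sum, smul_zero]
    have : ∀ t ∈ Finset.range (T + 1), d m j (c t • hlpA d δ t (m + 1) x) =
        c t • (hlpA d δ t m (d m 0 x) + t • hlpA d δ (t - 1) m (d m 0 x)) := by
      intro t _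
      rw [map_zsmul, hlp_A_face h h0 t m x hx j hj]
    rw [Finset.sum_congr rfl this, hlp_telescope c (fun t => hlpA d δ t m (d m 0 x)) T hc,
      hlp_A_zero h k hvanish T m (by omega) _ (hlp_d_mem h m x hx), smul_zero]
  refine ⟨((e.symm.toAddMonoidHom.comp S).comp (cohenAll G d (m + 1)).subtype).codRestrict
    (mooreAll G d (m + 1)) (fun x => hmem x x.2), ?_⟩
  intro x hx
  change e.symm (S x) = x
  apply (hbij (m + 1)).1
  simp only
  rw [he, hS, Finset.sum_range_succ']
  have hx' : ∀ j, j ≤ m + 1 → d m j (x : G (m + 1)) = 0 := hx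
  rw [Finset.sum_eq_zero]
  · rw [hc0]; simp [hlpA]
  · intro t _
    rw [hlpA_succ, hx' 0 (by omega)]; simp

theorem hlp_iter_pos (h : IsBiDelta G d δ) (m : ℕ) (z : G (m + 1)) (hz : d m 0 z = 0) (r : ℕ) :
    ∀ c : Fin (r + 1) → ℕ, StrictMono c → c (Fin.last r) ≤ m + 1 + r + 1 → 0 < c 0 →
      d (m + 1 + r) 0 (iterCoface G δ (m + 1) (r + 1) c z) = 0 := by
  induction r with
  | zero =>
    intro c hc hl hpos
    have h1 : c (Fin.last 0) = (c (Fin.last 0) - 1) + 1 := by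
      have : 0 < c (Fin.last 0) := hpos
      omega
    change d (m + 1) 0 (δ (m + 1) (c (Fin.last 0)) z) = 0
    rw [h1, h.face_coface_lt m _ 0 (Nat.zero_le _) (by omega) z, hz, map_zero]
  | succ r ih =>
    intro c hc hl hpos
    have hlt : c (Fin.last r).castSucc < c (Fin.last (r + 1)) := hc (Fin.castSucc_lt_last _)
    have h1 : c (Fin.last (r + 1)) = (c (Fin.last (r + 1)) - 1) + 1 := by omega
    have := ih (fun i => c i.castSucc) (fun a b hab => hc (Fin.castSucc_lt_castSucc_iff.2 hab))
      (by show c (Fin.last r).castSucc ≤ _; omega) (by simpa using hpos)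
    change d (m + 1 + r + 1) 0 (δ (m + 1 + r + 1) (c (Fin.last (r + 1)))
      (iterCoface G δ (m + 1) (r + 1) (fun i => c i.castSucc) z)) = 0
    rw [h1, h.face_coface_lt (m + 1 + r) _ 0 (Nat.zero_le _) (by omega), this, map_zero]

theorem hlp_iter_zero (h : IsBiDelta G d δ) (k : ℕ) (z : G k) (r : ℕ) :
    ∀ c : Fin r → ℕ, StrictMono c → (∀ i, c i ≤ k + r) →
      d (k + r) 0 (iterCoface G δ k (r + 1) (Fin.cons 0 fun i => c i + 1) z) =
        iterCoface G δ k r c z := by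
  induction r with
  | zero =>
    intro c hc hl
    exact h.face_coface_eq k 0 (by omega) z
  | succ r ih =>
    intro c hc hl
    have hl' := hl (Fin.last r)
    have := ih (fun i => c i.castSucc) (fun a b hab => hc (Fin.castSucc_lt_castSucc_iff.2 hab))
      (by
        intro i
        have h2 : c i.castSucc < c (Fin.last r) := hc (Fin.castSucc_lt_last _)
        omega)
    have h3 : (fun i : Fin (r + 1) =>
        (Fin.cons 0 (fun i => c i + 1) : Fin (r + 2) → ℕ) i.castSucc) =
        (Fin.cons 0 fun i : Fin r => c i.castSucc + 1) := by
      funext i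
      refine Fin.cases rfl (fun i => ?_) i
      rw [← Fin.succ_castSucc, Fin.cons_succ, Fin.cons_succ]
    change d (k + r + 1) 0 (δ (k + r + 1) (c (Fin.last r) + 1)
      (iterCoface G δ k (r + 1) (fun i : Fin (r + 1) =>
        (Fin.cons 0 (fun i => c i + 1) : Fin (r + 2) → ℕ) i.castSucc) z)) =
      δ (k + r) (c (Fin.last r)) (iterCoface G δ k r (fun i => c i.castSucc) z)
    rw [h.face_coface_lt (k + r) _ 0 (Nat.zero_le _) (by omega), h3, this]

theorem hlp_d_jamesHopf (h : IsBiDelta G d δ) (m : ℕ) (z : G (m + 1)) (hz : d m 0 z = 0) (r : ℕ) :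
    d (m + 1 + r) 0 (jamesHopf G δ (m + 1) (r + 1) z) = jamesHopf G δ (m + 1) r z := by
  classical
  unfold jamesHopf
  rw [map_sum]
  symm
  refine Finset.sum_of_injOn
    (fun c => (Fin.cons 0 (fun i => (c i).succ) : Fin (r + 1) → Fin (m + 1 + (r + 1) + 1)))
    ?_ ?_ ?_ ?_
  · intro a _ b _ hab
    funext i
    have := congrFun hab i.succ
    simpa using this
  · intro c hc
    have hc : StrictMono c := by simpa using hc
    have : StrictMono (Fin.cons 0 (fun i => (c i).succ) :
        Fin (r + 1) → Fin (m + 1 + (r + 1) + 1)) := by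
      intro a b hab
      induction b using Fin.cases with
      | zero => exact absurd hab (Fin.not_lt_zero _)
      | succ b =>
        induction a using Fin.cases with
        | zero => simp only [Fin.cons_zero, Fin.cons_succ]; exact Fin.succ_pos _
        | succ a =>
          simp only [Fin.cons_succ]
          exact Fin.succ_lt_succ_iff.2 (hc (Fin.succ_lt_succ_iff.1 hab))
    simpa using this
  · intro c hc hn
    have hc : StrictMono c := by simpa using hc
    refine hlp_iter_pos h m z hz r _ (fun a b hab => hc hab) (by omega) ?_
    by_contra h0
    apply hn
    have h00 : c 0 = 0 := Fin.ext (by simpa using h0)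
    have hpos : ∀ i : Fin r, c i.succ ≠ 0 := fun i hi => by
      have := hc (Fin.succ_pos i)
      rw [hi, h00] at this
      exact lt_irrefl _ this
    refine ⟨fun i => (c i.succ).pred (hpos i), ?_, ?_⟩
    · have : StrictMono fun i : Fin r => (c i.succ).pred (hpos i) := fun a b hab =>
        Fin.pred_lt_pred_iff.2 (hc (Fin.succ_lt_succ_iff.2 hab))
      simpa using this
    · funext i
      induction i using Fin.cases with
      | zero => simp [h00]
      | succ i => simp
  · intro c hc
    have hc : StrictMono c := by simpa using hc
    rw [← hlp_iter_zero h (m + 1) z r (fun i => (c i : ℕ)) (fun a b hab => hc hab)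
      (fun i => by omega)]
    congr 2
    funext i
    induction i using Fin.cases with
    | zero => rfl
    | succ i => simp

theorem hlp_dIter_jamesHopf (h : IsBiDelta G d δ) (m : ℕ) (z : G (m + 1)) (hz : d m 0 z = 0)
    (r : ℕ) : dIter G d (m + 1) r (jamesHopf G δ (m + 1) r z) = z := by
  induction r with
  | zero =>
    classical
    have : ∀ c : Fin 0 → Fin (m + 1 + 0 + 1), StrictMono c := fun c a => a.elim0
    simp [dIter, jamesHopf, iterCoface, this]
  | succ r ih =>
    change dIter G d (m + 1) r (d (m + 1 + r) 0 (jamesHopf G δ (m + 1) (r + 1) z)) = z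
    rw [hlp_d_jamesHopf h m z hz r, ih]

end Helpers

/-- Let `p` be a prime and `G` an abelian bi-Δ-group which is `p`-local
and satisfies `𝔥_i G = 0` for all `i ≤ k`. Then for every `m` with `1 ≤ m ≤ p + k`
(here the level is `m + 1 ≤ p + k`) there exists a homomorphism `π : 𝔥_m G → Z_m G`
restricting to the identity on `Z_m G`; and for every such `π` and every `n = m + r ≥ m`
the endomorphism `e_m^{(n)} = H_{m,n} ∘ i_m ∘ π ∘ p_{m,n}` of `𝔥_n G` is idempotent. -/
theorem stmt16 (G : ℕ → Type u) [∀ n, AddCommGroup (G n)]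
    (d : ∀ n : ℕ, ℕ → (G (n + 1) →+ G n)) (δ : ∀ n : ℕ, ℕ → (G n →+ G (n + 1)))
    (h : IsBiDelta G d δ) (p k : ℕ) (hp : p.Prime)
    (hloc : ∀ q : ℕ, q.Prime → q ≠ p → ∀ n, Function.Bijective fun x : G n => q • x)
    (hvanish : ∀ i ≤ k, ∀ x ∈ cohenAll G d i, x = 0)
    (m : ℕ) (hm : m + 1 ≤ p + k) :
    (∃ π : ↥(cohenAll G d (m + 1)) →+ ↥(mooreAll G d (m + 1)),
      ∀ x : ↥(cohenAll G d (m + 1)), (x : G (m + 1)) ∈ mooreAll G d (m + 1) →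
        ((π x : ↥(mooreAll G d (m + 1))) : G (m + 1)) = (x : G (m + 1))) ∧
    ∀ π : ↥(cohenAll G d (m + 1)) →+ ↥(mooreAll G d (m + 1)),
      (∀ x : ↥(cohenAll G d (m + 1)), (x : G (m + 1)) ∈ mooreAll G d (m + 1) →
        ((π x : ↥(mooreAll G d (m + 1))) : G (m + 1)) = (x : G (m + 1))) →
      ∀ (r : ℕ) (x : G (m + 1 + r)) (_ : x ∈ cohenAll G d (m + 1 + r))
        (h1 : dIter G d (m + 1) r x ∈ cohenAll G d (m + 1))
        (h3 : dIter G d (m + 1) r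
            (jamesHopf G δ (m + 1) r
              ((π ⟨dIter G d (m + 1) r x, h1⟩ : ↥(mooreAll G d (m + 1))) : G (m + 1)))
            ∈ cohenAll G d (m + 1)),
        jamesHopf G δ (m + 1) r
            ((π ⟨dIter G d (m + 1) r
                (jamesHopf G δ (m + 1) r
                  ((π ⟨dIter G d (m + 1) r x, h1⟩ :
                      ↥(mooreAll G d (m + 1))) : G (m + 1))),
              h3⟩ : ↥(mooreAll G d (m + 1))) : G (m + 1))
          = jamesHopf G δ (m + 1) r
              ((π ⟨dIter G d (m + 1) r x, h1⟩ : ↥(mooreAll G d (m + 1))) : G (m + 1)) := by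
  refine ⟨hlp_exists h p k hp hloc hvanish m hm, ?_⟩
  intro π hπ r x _ h1 h3
  have hz := (π ⟨dIter G d (m + 1) r x, h1⟩).2
  have hz0 : d m 0 (π ⟨dIter G d (m + 1) r x, h1⟩ : G (m + 1)) = 0 := hz 0 (Nat.zero_le _)
  have key := hlp_dIter_jamesHopf h m _ hz0 r
  congr 1
  rw [hπ _ (by simpa only [key] using hz)]
  exact key
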